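/- Let Λ be a block and λ, μ, ν ∈ Λ such that underline λ ν overline μ is an oriented circle diagram, and let C be a circle of the circle diagram (underline λ)(overline μ). Then the number of clockwise cups plus the number of clockwise caps among the arcs of C (with respect to the orientation ν) equals (number of cups contained in C) + 1 if C is oriented clockwise, and equals (number of cups contained in C) − 1 if C is oriented anticlockwise. -/

import Mathlib

namespace BK

/-- The symbols `∘, ×, ∨, ∧` labelling the integral positions of a weight. -/
inductive Symb : Type
  | circ : Symb
  | times : Symb
  | dn : Symb
  | up : Symb
  deriving DecidableEq

/-- A (diagrammatical) weight: a sequence of symbols indexed by `ℤ`, equal to `∘`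
for all but finitely many positions. -/
structure Weight : Type where
  lab : ℤ → Symb
  finite : {i : ℤ | lab i ≠ Symb.circ}.Finite

namespace Weight

/-- Two weights are equivalent (lie in the same block) if one is obtained from the
other by permuting the symbols `∧` and `∨`: the `∘`- and `×`-positions agree and the
number of `∧`'s agrees. -/
def Equiv (l m : Weight) : Prop :=
  (∀ i, l.lab i = Symb.circ ↔ m.lab i = Symb.circ) ∧
  (∀ i, l.lab i = Symb.times ↔ m.lab i = Symb.times) ∧
  {i | l.lab i = Symb.up}.ncard = {i | m.lab i = Symb.up}.ncard

/-- The vertices of (the block of) a weight: the positions carrying `∧` or `∨`,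
i.e. the positions where the block sequence has the symbol `★`. -/
def vertices (l : Weight) : Set ℤ :=
  {i | l.lab i = Symb.up ∨ l.lab i = Symb.dn}

/-- `up(Λ)`: the number of `∧`'s plus the number of `×`'s. -/
noncomputable def upNum (l : Weight) : ℕ :=
  {i | l.lab i = Symb.up}.ncard + {i | l.lab i = Symb.times}.ncard

/-- `down(Λ)`: the number of `∨`'s plus the number of `×`'s. -/
noncomputable def downNum (l : Weight) : ℕ :=
  {i | l.lab i = Symb.dn}.ncard + {i | l.lab i = Symb.times}.ncard

/-- A block is balanced if `up(Λ) = down(Λ)`. -/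
def Balanced (l : Weight) : Prop := l.upNum = l.downNum

end Weight

/-- A cup diagram (equally: the datum of a cap diagram, via the mirror image):
a set of cups `(i, j)` with `i < j` and a set of rays `i`. -/
@[ext]
structure CupDiagram : Type where
  cups : Set (ℤ × ℤ)
  rays : Set ℤ

namespace CupDiagram

/-- Compatibility of a cup diagram with the vertex set `V` of a block: endpoints lie in
`V` and are increasing, every vertex lies in exactly one arc, cups do not cross, and no
ray lies under a cup. -/
def IsCompatible (c : CupDiagram) (V : Set ℤ) : Prop :=
  (∀ p ∈ c.cups, p.1 < p.2) ∧
  (∀ p ∈ c.cups, p.1 ∈ V ∧ p.2 ∈ V) ∧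
  c.rays ⊆ V ∧
  (∀ v ∈ V, v ∈ c.rays ∨ ∃ p ∈ c.cups, v = p.1 ∨ v = p.2) ∧
  (∀ p ∈ c.cups, ∀ q ∈ c.cups,
    (p.1 = q.1 ∨ p.1 = q.2 ∨ p.2 = q.1 ∨ p.2 = q.2) → p = q) ∧
  (∀ p ∈ c.cups, p.1 ∉ c.rays ∧ p.2 ∉ c.rays) ∧
  (∀ p ∈ c.cups, ∀ q ∈ c.cups, ¬(p.1 < q.1 ∧ q.1 < p.2 ∧ p.2 < q.2)) ∧
  (∀ p ∈ c.cups, ∀ k ∈ c.rays, ¬(p.1 < k ∧ k < p.2))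

/-- The diagram `cλ` is oriented: every cup has exactly one endpoint `∨` and one `∧`,
every ray vertex is labeled `∨` or `∧`, and there are no rays `i < j` with
`λ_i = ∨` and `λ_j = ∧`. -/
def Oriented (c : CupDiagram) (l : Weight) : Prop :=
  (∀ p ∈ c.cups,
    (l.lab p.1 = Symb.dn ∧ l.lab p.2 = Symb.up) ∨
    (l.lab p.1 = Symb.up ∧ l.lab p.2 = Symb.dn)) ∧
  (∀ k ∈ c.rays, l.lab k = Symb.up ∨ l.lab k = Symb.dn) ∧
  (∀ i ∈ c.rays, ∀ j ∈ c.rays, i < j → ¬(l.lab i = Symb.dn ∧ l.lab j = Symb.up))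

/-- The degree of `cλ`: the number of clockwise cups (cups whose rightmost vertex is
labeled `∨`).  Applied to the mirror cap diagram this is the number of clockwise caps. -/
noncomputable def deg (c : CupDiagram) (l : Weight) : ℕ :=
  {p ∈ c.cups | l.lab p.2 = Symb.dn}.ncard

end CupDiagram

/-- `c` is the cup diagram `underline l` of the weight `l`: it is compatible with the
block of `l`, the diagram `c l` is oriented, and `deg (c l) = 0`. -/
def IsLowerDiagram (c : CupDiagram) (l : Weight) : Prop :=
  c.IsCompatible l.vertices ∧ c.Oriented l ∧ c.deg l = 0

/-- Adjacency of vertices in the circle diagram `c d*`: two vertices are adjacent when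
they are joined by a cup of `c` or a cap of `d*`. -/
def adjArc (c d : CupDiagram) (v w : ℤ) : Prop :=
  (v, w) ∈ c.cups ∨ (w, v) ∈ c.cups ∨ (v, w) ∈ d.cups ∨ (w, v) ∈ d.cups

/-- `S` is a connected component of the circle diagram `c d*`. -/
def IsComponent (c d : CupDiagram) (S : Set ℤ) : Prop :=
  ∃ v ∈ S, S = {w | Relation.ReflTransGen (adjArc c d) v w}

/-- `S` is a circle of the circle diagram `c d*`: a connected component containing
no ray. -/
def IsCircle (c d : CupDiagram) (S : Set ℤ) : Prop :=
  IsComponent c d S ∧ ∀ v ∈ S, v ∉ c.rays ∧ v ∉ d.rays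

/-- The degree of the oriented circle diagram `c n d*`: the number of clockwise cups
of `c n` plus the number of clockwise caps of `n d*`. -/
noncomputable def degCirc (c d : CupDiagram) (n : Weight) : ℕ :=
  {p ∈ c.cups | n.lab p.2 = Symb.dn}.ncard + {p ∈ d.cups | n.lab p.2 = Symb.dn}.ncard

/-- The position `p_Λ(i)` of `i` in the block of `l`. -/
noncomputable def posn (l : Weight) (i : ℤ) : ℕ :=
  {j | j ≤ i ∧ (l.lab j = Symb.up ∨ l.lab j = Symb.dn)}.ncard +
    2 * {j | j ≤ i ∧ l.lab j = Symb.times}.ncard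

/-- The distance `d_Λ(γ) = |p_Λ(i) − p_Λ(j)|` of an arc `γ = {i, j}`. -/
noncomputable def arcDist (l : Weight) (i j : ℤ) : ℕ := ((posn l i : ℤ) - (posn l j : ℤ)).natAbs


/-- `f` restricts to a fixed-point-free involution of `S` whose orbits, drawn as arcs on one
side of a line, do not cross. -/
structure IsNoncrossingMatching (S : Finset ℤ) (f : ℤ → ℤ) : Prop where
  mem : ∀ x ∈ S, f x ∈ S
  invol : ∀ x ∈ S, f (f x) = x
  ne : ∀ x ∈ S, f x ≠ x
  noncrossing : ∀ x ∈ S, ∀ y ∈ S, ¬(x < y ∧ y < f x ∧ f x < f y)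

/-- The sum of the labels of the right endpoints of the arcs of the matching `f`. -/
def rightSum (S : Finset ℤ) (f e : ℤ → ℤ) : ℤ :=
  ∑ x ∈ S, if f x < x then e x else 0

/-- The matching obtained from `g` by deleting the points `i` and `j` and joining their
partners. -/
def joinPartners (g : ℤ → ℤ) (i j x : ℤ) : ℤ :=
  if x = g i then g j else if x = g j then g i else g x

namespace IsNoncrossingMatching

variable {S : Finset ℤ} {f g e : ℤ → ℤ} {i j : ℤ}

/-- The arc with the leftmost right endpoint joins two consecutive points. -/
lemma exists_consecutive (hf : IsNoncrossingMatching S f) (hS : S.Nonempty) :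
    ∃ i ∈ S, i < f i ∧ (∀ x ∈ S, ¬(i < x ∧ x < f i)) ∧
      ∀ x ∈ S, f x < x → f i ≤ x := by
  obtain ⟨hmem, hinv, hne, hnc⟩ := hf
  have hR : (S.filter fun x => f x < x).Nonempty := by
    obtain ⟨x, hx⟩ := hS
    rcases lt_or_gt_of_ne (hne x hx) with h | h
    · exact ⟨x, by simp [hx, h]⟩
    · exact ⟨f x, by simp [hmem x hx, hinv x hx, h]⟩
  obtain ⟨j, hj, hjmin⟩ := Finset.exists_min_image _ id hR
  simp only [Finset.mem_filter, id] at hj hjmin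
  obtain ⟨hjS, hjlt⟩ := hj
  refine ⟨f j, hmem j hjS, by rwa [hinv j hjS], ?_, ?_⟩
  · rintro x hx ⟨h1, h2⟩
    rw [hinv j hjS] at h2
    have hxS := hmem x hx
    have a1 := hnc (f j) (hmem j hjS) x hx
    have a2 := hnc (f x) hxS (f j) (hmem j hjS)
    have a3 := hjmin x
    have a4 := hjmin (f x)
    rw [hinv j hjS] at a1 a2
    rw [hinv x hx] at a2 a4
    have a5 := hne x hx
    have a6 := hinv x hx
    have a7 := hinv j hjS
    have a8 : f x ≠ j := by rintro rfl; omega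
    have a9 : f x ≠ f j := by intro h; rw [h] at a6; omega
    rcases lt_or_gt_of_ne a5 with h | h
    · exact absurd (a3 ⟨hx, h⟩) (by omega)
    · exact absurd (a4 ⟨hxS, h⟩) (by omega)
  · intro x hx h
    rw [hinv j hjS]
    exact hjmin x ⟨hx, h⟩

lemma erase_pair (hf : IsNoncrossingMatching S f) (hi : i ∈ S) :
    IsNoncrossingMatching ((S.erase i).erase (f i)) f := by
  obtain ⟨hmem, hinv, hne, hnc⟩ := hf
  have := hinv i hi
  constructor
  · intro x hx
    simp only [Finset.mem_erase] at hx ⊢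
    have := hinv x hx.2.2
    grind
  · grind
  · grind
  · intro x hx y hy
    exact hnc x (by grind) y (by grind)

/-- A point lies under an arc if and only if its partner does. -/
lemma inside_iff (hg : IsNoncrossingMatching S g) {u v : ℤ} (hu : u ∈ S) (hv : v ∈ S)
    (hvu : v ≠ u) (hvgu : v ≠ g u) :
    (u < v ∧ v < g u ∨ g u < v ∧ v < u) ↔ (u < g v ∧ g v < g u ∨ g u < g v ∧ g v < u) := by
  obtain ⟨hmem, hinv, hfix, hnc⟩ := hg
  have iu := hinv u hu
  have iv := hinv v hv
  have n1 : g v ≠ u := by grind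
  have n2 : g v ≠ g u := by grind
  have hgu := hmem u hu
  have hgv := hmem v hv
  have a1 := hnc u hu v hv
  have a2 := hnc u hu (g v) hgv
  have a3 := hnc (g u) hgu v hv
  have a4 := hnc (g u) hgu (g v) hgv
  have b1 := hnc v hv u hu
  have b2 := hnc v hv (g u) hgu
  have b3 := hnc (g v) hgv u hu
  have b4 := hnc (g v) hgv (g u) hgu
  rw [iu] at a3 a4 b2 b4
  rw [iv] at a2 a4 b3 b4
  rcases lt_or_gt_of_ne (hfix u hu) with h | h <;> constructor <;> omega

lemma joinPartners (hg : IsNoncrossingMatching S g) (hi : i ∈ S) (hj : j ∈ S) (hij : i < j)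
    (hcons : ∀ x ∈ S, ¬(i < x ∧ x < j)) (hne : g i ≠ j) :
    IsNoncrossingMatching ((S.erase i).erase j) (joinPartners g i j) := by
  obtain ⟨hmem, hinv, hfix, hnc⟩ := hg
  have hgi := hinv i hi
  have hgj := hinv j hj
  constructor
  · intro x hx
    simp only [Finset.mem_erase, BK.joinPartners] at hx ⊢
    have := hinv x hx.2.2
    grind
  · intro x hx
    simp only [Finset.mem_erase, BK.joinPartners] at hx ⊢
    have := hinv x hx.2.2
    grind
  · intro x hx
    simp only [Finset.mem_erase, BK.joinPartners] at hx ⊢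
    have := hinv x hx.2.2
    grind
  · intro x hx y hy
    simp only [Finset.mem_erase] at hx hy
    have hpartner : ∀ u ∈ S, u ≠ g i → u ≠ g j → g u ≠ i ∧ g u ≠ j := fun u hu h1 h2 => by
      have := hinv u hu
      grind
    have hsame : ∀ u ∈ S, u ≠ i → u ≠ j → u ≠ g i → u ≠ g j →
        ((u < g i ∧ g i < g u ∨ g u < g i ∧ g i < u) ↔
          (u < g j ∧ g j < g u ∨ g u < g j ∧ g j < u)) := by
      intro u hu hui huj hua hub
      obtain ⟨hgui, hguj⟩ := hpartner u hu hua hub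
      have hgu := hmem u hu
      have c1 := hcons u hu
      have c2 := hcons (g u) hgu
      refine (inside_iff ⟨hmem, hinv, hfix, hnc⟩ hu hi hui.symm hgui.symm).symm.trans
        (Iff.trans ?_ (inside_iff ⟨hmem, hinv, hfix, hnc⟩ hu hj huj.symm hguj.symm))
      omega
    simp only [BK.joinPartners]
    rintro ⟨h1, h2, h3⟩
    by_cases hxs : x = g i ∨ x = g j
    · by_cases hys : y = g i ∨ y = g j
      · grind
      · push Not at hys
        rw [if_neg hys.1, if_neg hys.2] at h3
        have := hsame y hy.2.2 hy.2.1 hy.1 hys.1 hys.2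
        rcases hxs with rfl | rfl <;> split_ifs at h2 h3 <;> omega
    · push Not at hxs
      rw [if_neg hxs.1, if_neg hxs.2] at h2 h3
      by_cases hys : y = g i ∨ y = g j
      · have := hsame x hx.2.2 hx.2.1 hx.1 hxs.1 hxs.2
        rcases hys with rfl | rfl <;> split_ifs at h3 <;> omega
      · push Not at hys
        rw [if_neg hys.1, if_neg hys.2] at h3
        exact hnc x hx.2.2 y hy.2.2 ⟨h1, h2, h3⟩

lemma rightSum_erase_pair (hf : IsNoncrossingMatching S f) (hi : i ∈ S) (hlt : i < f i) :
    rightSum S f e = rightSum ((S.erase i).erase (f i)) f e + e (f i) := by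
  have hj : f i ∈ S.erase i := by simp [hf.ne i hi, hf.mem i hi]
  rw [rightSum, rightSum, ← Finset.add_sum_erase S _ hi, ← Finset.add_sum_erase _ _ hj,
    hf.invol i hi, if_neg (by omega), if_pos hlt]
  ring

lemma rightSum_joinPartners (hg : IsNoncrossingMatching S g) (hi : i ∈ S) (hj : j ∈ S)
    (hij : i < j) (hcons : ∀ x ∈ S, ¬(i < x ∧ x < j)) (hne : g i ≠ j)
    (he : ∀ x ∈ S, e (g x) = -e x) (hopp : e j = -e i) :
    rightSum S g e + e j = rightSum ((S.erase i).erase j) (BK.joinPartners g i j) e := by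
  obtain ⟨hmem, hinv, hfix, hnc⟩ := hg
  have hgi := hinv i hi
  have hgj := hinv j hj
  have hab : g i ≠ g j := by grind
  have ha : g i ∈ (S.erase i).erase j := by grind
  have hb : g j ∈ ((S.erase i).erase j).erase (g i) := by grind
  have hj' : j ∈ S.erase i := by grind
  have hrest : ∑ x ∈ ((((S.erase i).erase j).erase (g i)).erase (g j)),
        (if BK.joinPartners g i j x < x then e x else 0) =
      ∑ x ∈ ((((S.erase i).erase j).erase (g i)).erase (g j)),
        (if g x < x then e x else 0) := by
    refine Finset.sum_congr rfl fun x hx => ?_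
    simp only [Finset.mem_erase] at hx
    simp [BK.joinPartners, hx.1, hx.2.1]
  have e1 := he i hi
  have e2 := he j hj
  have ja : BK.joinPartners g i j (g i) = g j := by simp [BK.joinPartners]
  have jb : BK.joinPartners g i j (g j) = g i := by simp [BK.joinPartners, hab.symm]
  rw [rightSum, rightSum, ← Finset.add_sum_erase S _ hi, ← Finset.add_sum_erase _ _ hj',
    ← Finset.add_sum_erase _ _ ha, ← Finset.add_sum_erase _ _ hb,
    ← Finset.add_sum_erase _ _ ha, ← Finset.add_sum_erase _ _ hb, hrest, ja, jb, hgi, hgj, e1, e2,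
    hopp]
  have n1 := hnc (g i) (hmem i hi) (g j) (hmem j hj)
  have n2 := hnc i hi j hj
  have n3 := hnc (g j) (hmem j hj) i hi
  have n4 := hnc (g i) (hmem i hi) j hj
  have c1 := hcons (g i) (hmem i hi)
  have c2 := hcons (g j) (hmem j hj)
  have f1 := hfix i hi
  have f2 := hfix j hj
  rw [hgi, hgj] at n1
  rw [hgj] at n3
  rw [hgi] at n4
  have hb' : g j ≠ i := by grind
  split_ifs <;> omega

/-- A closed connected meander has turning number `±1`: the labels of the right endpoints of
its arcs, upper and lower, sum to twice the label of its rightmost point. -/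
theorem rightSum_add_rightSum (hf : IsNoncrossingMatching S f) (hg : IsNoncrossingMatching S g)
    (hef : ∀ x ∈ S, e (f x) = -e x) (heg : ∀ x ∈ S, e (g x) = -e x)
    (hconn : ∀ T ⊆ S, T.Nonempty → (∀ x ∈ T, f x ∈ T ∧ g x ∈ T) → T = S)
    {t : ℤ} (ht : t ∈ S) (htmax : ∀ x ∈ S, x ≤ t) :
    rightSum S f e + rightSum S g e = 2 * e t := by
  induction hn : S.card using Nat.strong_induction_on generalizing S g with
  | _ n ih =>
  obtain ⟨i, hi, hlt, hcons, hmin⟩ := hf.exists_consecutive ⟨t, ht⟩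
  have hj := hf.mem i hi
  have hfj := hf.invol i hi
  by_cases hgi : g i = f i
  · have hS : {i, f i} = S := hconn {i, f i} (by grind) (by simp) (by
      have := hg.invol i hi
      grind)
    have htj : t = f i := by
      have := htmax _ hj
      grind
    have hgj : g (f i) = i := by rw [← hgi, hg.invol i hi]
    rw [rightSum, rightSum, ← hS, Finset.sum_pair hlt.ne, Finset.sum_pair hlt.ne, hfj, hgj, hgi,
      htj]
    simp [hlt, hlt.not_gt]
    ring
  · have hsub : ∀ x ∈ (S.erase i).erase (f i), x ∈ S := by grind
    have hti : t ≠ i := by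
      have := htmax _ hj
      omega
    have htj : t ≠ f i := by
      intro h
      have haS := hg.mem i hi
      have h1 := hmin _ haS
      have h2 := hmin _ (hf.mem _ haS)
      have h3 := htmax _ haS
      have h4 := htmax _ (hf.mem _ haS)
      have h5 := hf.invol _ haS
      have h6 := hf.ne _ haS
      have h7 := hg.ne i hi
      grind
    have hgfi : g (f i) ≠ i := by
      have := hg.invol _ hj
      grind
    have key := ih _ (hn ▸ Finset.card_erase_le.trans_lt (Finset.card_erase_lt_of_mem hi))
      (hf.erase_pair hi) (hg.joinPartners hi hj hlt hcons hgi)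
      (fun x hx => hef x (hsub x hx))
      (fun x hx => by
        have := heg x (hsub x hx)
        have := heg i hi
        have := heg _ hj
        have := hef i hi
        simp only [BK.joinPartners]
        split_ifs <;> simp_all)
      (fun T hT hTne hcl => by
        have hinv := hg.invol
        have hfinv := hf.invol
        have hTS : T ⊆ S := fun x hx => hsub x (hT hx)
        have hnot : i ∉ T ∧ f i ∉ T := by grind
        by_cases ha : g i ∈ T
        · have hb : g (f i) ∈ T := by simpa [BK.joinPartners] using (hcl _ ha).2
          have hTU : insert i (insert (f i) T) = S := by
            refine hconn _ (by grind) (by simp) fun x hx => ?_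
            have := hcl x
            simp only [BK.joinPartners] at this
            grind
          have hi' : i ∉ insert (f i) T := by simp [hlt.ne, hnot.1]
          rw [← hTU, Finset.erase_insert hi', Finset.erase_insert hnot.2]
        · have hb : g (f i) ∉ T := fun hb => ha <| by
            have := (hcl _ hb).2
            simp only [BK.joinPartners] at this
            grind
          have hTU : T = S := by
            refine hconn _ hTS hTne fun x hx => ?_
            have := hcl x hx
            simp only [BK.joinPartners] at this
            grind
          exact absurd (hTU ▸ hi) hnot.1)
      (by grind) (fun x hx => htmax x (hsub x hx)) rfl
    rw [hf.rightSum_erase_pair hi hlt]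
    have := hg.rightSum_joinPartners hi hj hlt hcons hgi heg (hef i hi)
    linarith

/-- Half of the points of a matching are right endpoints. -/
lemma two_mul_card_right (hf : IsNoncrossingMatching S f) :
    2 * (S.filter fun x => f x < x).card = S.card := by
  have h1 : (S.filter fun x => f x < x).card = (S.filter fun x => ¬ f x < x).card := by
    refine Finset.card_nbij' f f ?_ ?_ ?_ ?_
    · intro x hx
      have := hf.mem x
      have := hf.invol x
      grind
    · intro x hx
      have := hf.mem x
      have := hf.invol x
      have := hf.ne x
      grind
    · intro x hx
      exact hf.invol x (by grind)
    · intro x hx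
      exact hf.invol x (by grind)
  have h2 := Finset.card_filter_add_card_filter_not (s := S) (fun x => f x < x)
  omega

end IsNoncrossingMatching

/-- With labels `1` on `P` and `-1` off `P`, the sum over right endpoints counts those in `P`
twice, minus the number of arcs. -/
lemma rightSum_ite (S : Finset ℤ) (f : ℤ → ℤ) (P : ℤ → Prop) [DecidablePred P] :
    rightSum S f (fun x => if P x then 1 else -1) =
      2 * ((S.filter fun x => f x < x ∧ P x).card : ℤ) - (S.filter fun x => f x < x).card := by
  rw [rightSum, Finset.card_filter, Finset.card_filter]
  push_cast
  rw [Finset.mul_sum, ← Finset.sum_sub_distrib]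
  refine Finset.sum_congr rfl fun x _ => ?_
  split_ifs <;> simp_all

namespace CupDiagram

/-- The arcs of a compatible diagram without rays on a union `S` of components form a
noncrossing matching of `S`. -/
lemma IsCompatible.exists_matching {c : CupDiagram} {V : Set ℤ} (hc : c.IsCompatible V)
    {S : Finset ℤ} (hSV : ∀ x ∈ S, x ∈ V) (hray : ∀ x ∈ S, x ∉ c.rays)
    (hcl : ∀ p ∈ c.cups, p.1 ∈ S ↔ p.2 ∈ S) :
    ∃ f : ℤ → ℤ, IsNoncrossingMatching S f ∧
      ∀ x ∈ S, (x < f x ∧ (x, f x) ∈ c.cups) ∨ (f x < x ∧ (f x, x) ∈ c.cups) := by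
  obtain ⟨hlt, -, -, hcov, huniq, -, hnc, -⟩ := hc
  have hex : ∀ x, ∃ y, x ∈ S → (x < y ∧ (x, y) ∈ c.cups) ∨ (y < x ∧ (y, x) ∈ c.cups) := by
    intro x
    by_cases hx : x ∈ S
    · obtain h | ⟨p, hp, rfl | rfl⟩ := hcov x (hSV x hx)
      · exact absurd h (hray x hx)
      · exact ⟨p.2, fun _ => Or.inl ⟨hlt p hp, hp⟩⟩
      · exact ⟨p.1, fun _ => Or.inr ⟨hlt p hp, hp⟩⟩
    · exact ⟨x, fun h => absurd h hx⟩
  choose f hf using hex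
  have hmem : ∀ x ∈ S, f x ∈ S := by
    intro x hx
    rcases hf x hx with h | h
    · exact (hcl _ h.2).1 hx
    · exact (hcl _ h.2).2 hx
  refine ⟨f, ⟨hmem, fun x hx => ?_, fun x hx => ?_, ?_⟩, hf⟩
  · have hfx := hf _ (hmem x hx)
    rcases hf x hx with h | h <;> rcases hfx with h' | h' <;>
      have := huniq _ h.2 _ h'.2 <;> grind
  · have := hf x hx
    omega
  · rintro x hx y hy ⟨h1, h2, h3⟩
    have hx' := hf x hx
    have hy' := hf y hy
    have hxc : (x, f x) ∈ c.cups := by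
      rcases hx' with h | h
      · exact h.2
      · omega
    have hyc : (y, f y) ∈ c.cups := by
      rcases hy' with h | h
      · exact h.2
      · omega
    exact hnc _ hxc _ hyc ⟨h1, h2, h3⟩

/-- Arcs inside `S` correspond to their right endpoints. -/
lemma ncard_arcs_eq {c : CupDiagram} {V : Set ℤ} (hc : c.IsCompatible V)
    {S : Finset ℤ} {f : ℤ → ℤ} (hmem : ∀ x ∈ S, f x ∈ S)
    (hf : ∀ x ∈ S, (x < f x ∧ (x, f x) ∈ c.cups) ∨ (f x < x ∧ (f x, x) ∈ c.cups))
    (P : ℤ → Prop) [DecidablePred P] :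
    {p ∈ c.cups | p.1 ∈ S ∧ p.2 ∈ S ∧ P p.2}.ncard =
      (S.filter fun x => f x < x ∧ P x).card := by
  obtain ⟨hlt, -, -, -, huniq, -, -, -⟩ := hc
  rw [← Set.ncard_coe_finset]
  refine Set.ncard_congr (fun p _ => p.2) ?_ ?_ ?_
  · rintro p ⟨hp, h1, h2, h3⟩
    have hpf : (f p.2 < p.2) := by
      have := hlt p hp
      rcases hf _ h2 with h | h
      · have := huniq _ hp _ h.2
        grind
      · exact h.1
    simp [h2, h3, hpf]
  · rintro p q ⟨hp, -⟩ ⟨hq, -⟩ h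
    exact huniq p hp q hq (by simp [h])
  · intro x hx
    simp only [Finset.coe_filter, Set.mem_ofPred_eq] at hx
    refine ⟨(f x, x), ⟨?_, hmem x hx.1, hx.1, hx.2.2⟩, rfl⟩
    rcases hf x hx.1 with h | h
    · omega
    · exact h.2

end CupDiagram

namespace Weight

lemma Equiv.vertices_eq {l m : Weight} (h : l.Equiv m) : l.vertices = m.vertices := by
  ext i
  have h1 := h.1 i
  have h2 := h.2.1 i
  simp only [vertices, Set.mem_ofPred_eq]
  cases hl : l.lab i <;> cases hm : m.lab i <;> simp_all

lemma finite_vertices (l : Weight) : l.vertices.Finite := by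
  refine l.finite.subset fun i hi => ?_
  rcases hi with h | h <;> simp [h]

end Weight

/-- Lemma "deg(C) = (number of cups in C) ± 1": for an oriented circle diagram
`underline λ ν overline μ` and a circle `C` of `(underline λ)(overline μ)` with
rightmost vertex `t`, the number of clockwise cups plus the number of clockwise caps
among the arcs of `C` equals the number of cups contained in `C` plus `1` if `C` is
oriented clockwise (`ν_t = ∨`), and that number minus `1` if `C` is oriented
anticlockwise (`ν_t = ∧`). -/
theorem circle_degree_formula (l m n : Weight)
    (hlm : l.Equiv m) (hln : l.Equiv n)
    (c d : CupDiagram)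
    (hc : IsLowerDiagram c l) (hd : IsLowerDiagram d m)
    (hcn : c.Oriented n) (hdn : d.Oriented n)
    (S : Set ℤ) (hS : IsCircle c d S)
    (t : ℤ) (ht : t ∈ S) (htmax : ∀ v ∈ S, v ≤ t) :
    (n.lab t = Symb.dn →
      {p ∈ c.cups | p.1 ∈ S ∧ p.2 ∈ S ∧ n.lab p.2 = Symb.dn}.ncard +
        {p ∈ d.cups | p.1 ∈ S ∧ p.2 ∈ S ∧ n.lab p.2 = Symb.dn}.ncard =
      {p ∈ c.cups | p.1 ∈ S ∧ p.2 ∈ S}.ncard + 1) ∧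
    (n.lab t = Symb.up →
      {p ∈ c.cups | p.1 ∈ S ∧ p.2 ∈ S ∧ n.lab p.2 = Symb.dn}.ncard +
        {p ∈ d.cups | p.1 ∈ S ∧ p.2 ∈ S ∧ n.lab p.2 = Symb.dn}.ncard + 1 =
      {p ∈ c.cups | p.1 ∈ S ∧ p.2 ∈ S}.ncard) := by
  by_cases htV : t ∈ l.vertices
  swap
  · rw [hln.vertices_eq] at htV
    exact ⟨fun h => absurd (Or.inr h) htV, fun h => absurd (Or.inl h) htV⟩
  have hcC := hc.1
  have hdC := hd.1
  rw [← hlm.vertices_eq] at hdC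
  obtain ⟨⟨v, -, hSv⟩, hray⟩ := hS
  have hsymm : ∀ x y, adjArc c d x y → adjArc c d y x := by
    intro x y h
    unfold adjArc at h ⊢
    tauto
  have hadj : ∀ x y, adjArc c d x y → (x ∈ S ↔ y ∈ S) := by
    intro x y h
    rw [hSv]
    exact ⟨fun hx => hx.tail h, fun hy => hy.tail (hsymm x y h)⟩
  have hreach : ∀ x ∈ S, ∀ y ∈ S, Relation.ReflTransGen (adjArc c d) x y := by
    intro x hx y hy
    rw [hSv] at hx hy
    have : Std.Symm (adjArc c d) := ⟨hsymm⟩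
    exact (Std.Symm.symm (r := Relation.ReflTransGen (adjArc c d)) _ _ hx).trans hy
  have hSV : S ⊆ l.vertices := by
    intro x hx
    induction hreach t ht x hx with
    | refl => exact htV
    | tail _ h _ =>
      rcases h with h | h | h | h
      · exact (hcC.2.1 _ h).2
      · exact (hcC.2.1 _ h).1
      · exact (hdC.2.1 _ h).2
      · exact (hdC.2.1 _ h).1
  lift S to Finset ℤ using l.finite_vertices.subset hSV
  simp only [Finset.mem_coe] at *
  obtain ⟨f, hf, hfc⟩ := hcC.exists_matching (S := S) (fun x hx => hSV hx)
    (fun x hx => (hray x hx).1) (fun p hp => hadj _ _ (Or.inl hp))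
  obtain ⟨g, hg, hgd⟩ := hdC.exists_matching (S := S) (fun x hx => hSV hx)
    (fun x hx => (hray x hx).2) (fun p hp => hadj _ _ (Or.inr (Or.inr (Or.inl hp))))
  have hsum := hf.rightSum_add_rightSum hg
    (e := fun x => if n.lab x = Symb.dn then 1 else -1)
    (fun x hx => by
      rcases hfc x hx with h | h <;> rcases hcn.1 _ h.2 with h' | h' <;> simp [h'.1, h'.2])
    (fun x hx => by
      rcases hgd x hx with h | h <;> rcases hdn.1 _ h.2 with h' | h' <;> simp [h'.1, h'.2])
    (fun T hTS hT hcl => by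
      obtain ⟨x, hx⟩ := hT
      refine Finset.Subset.antisymm hTS fun y hy => ?_
      induction hreach x (hTS hx) y hy with
      | refl => exact hx
      | tail _ h ih =>
        rename_i b z _
        have hbT := ih ((hadj _ _ h).2 hy)
        have hbS := hTS hbT
        have hfb := hfc b hbS
        have hgb := hgd b hbS
        have hcb := hcl b hbT
        have huc := hcC.2.2.2.2.1
        have hud := hdC.2.2.2.2.1
        have : z = f b ∨ z = g b := by
          rcases h with h | h | h | h
          · left; rcases hfb with h' | h' <;> have := huc _ h _ h'.2 <;> grind
          · left; rcases hfb with h' | h' <;> have := huc _ h _ h'.2 <;> grind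
          · right; rcases hgb with h' | h' <;> have := hud _ h _ h'.2 <;> grind
          · right; rcases hgb with h' | h' <;> have := hud _ h _ h'.2 <;> grind
        rcases this with rfl | rfl
        · exact hcb.1
        · exact hcb.2)
    ht htmax
  rw [rightSum_ite, rightSum_ite] at hsum
  have hcc := CupDiagram.ncard_arcs_eq hcC hf.mem hfc fun _ => True
  simp only [and_true] at hcc
  rw [CupDiagram.ncard_arcs_eq hcC hf.mem hfc fun x => n.lab x = Symb.dn,
    CupDiagram.ncard_arcs_eq hdC hg.mem hgd fun x => n.lab x = Symb.dn, hcc]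
  have hcf := hf.two_mul_card_right
  have hcg := hg.two_mul_card_right
  constructor <;> intro h <;> simp only [h] at hsum <;> simp at hsum <;> omega

end BK
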